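/- Let N ≥ 16 be a real number and let k be an integer with k ≥ 2·(ln N / ln ln N)^{1/2}. Then (e² / k^{k−1})^{k+1} ≤ 1/N. Consequently, for integers Δ ≥ 1 and n ≥ 1 with 2·Δ·n ≥ 16, if k ≥ 2·(ln(2Δn)/ln ln(2Δn))^{1/2} then Δ·(e²/k^{k−1})^{k+1} ≤ 1/(2n). -/

import Mathlib

/-- Bounds on `k`, and on `L` in terms of `k`, when `k ≥ 2 * √(L / log L)`. -/
lemma three_lt_and_le_sq_mul_log_sub {L k : ℝ} (hL : 1 < L)
    (hk : 2 * √(L / Real.log L) ≤ k) : 3 < k ∧ L ≤ k ^ 2 * (Real.log k - 0.84) := by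
  have hlog : 0 < Real.log L := Real.log_pos hL
  have hq : 0 < L / Real.log L := by positivity
  have hk0 : 0 < k := lt_of_lt_of_le (by positivity) hk
  have hsq : 4 * (L / Real.log L) ≤ k ^ 2 := by
    calc 4 * (L / Real.log L) = (2 * √(L / Real.log L)) ^ 2 := by
          rw [mul_pow, Real.sq_sqrt hq.le]; norm_num
      _ ≤ k ^ 2 := by gcongr
  have hmain : 4 * L ≤ k ^ 2 * Real.log L := by
    rwa [← mul_div_assoc, div_le_iff₀ hlog] at hsq
  constructor
  · have he : Real.log L ≤ L / Real.exp 1 := by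
      have := Real.log_le_sub_one_of_pos (show 0 < L / Real.exp 1 by positivity)
      rw [Real.log_div (by positivity) (by positivity), Real.log_exp] at this
      linarith
    have hee : 4 * Real.exp 1 ≤ k ^ 2 := by
      rw [le_div_iff₀ (Real.exp_pos 1)] at he
      refine le_of_mul_le_mul_right ?_ hlog
      linarith
    nlinarith [Real.exp_one_gt_d9]
  · have hc := Real.log_le_sub_one_of_pos (show 0 < L / (k ^ 2 / 2) by positivity)
    rw [Real.log_div (by positivity) (by positivity), Real.log_div (by positivity) (by norm_num),
      Real.log_pow] at hc
    have hcancel : k ^ 2 * (L / (k ^ 2 / 2)) = 2 * L := by field_simp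
    have hmul := mul_le_mul_of_nonneg_left hc (sq_nonneg k)
    have hlog2 := mul_le_mul_of_nonneg_left Real.log_two_gt_d9.le (sq_nonneg k)
    push_cast at hmul
    nlinarith [sq_nonneg k]

lemma exp_sq_div_pow_pow_le_one_div {N : ℝ} {k : ℕ} (hN : 16 ≤ N)
    (hk : 2 * √(Real.log N / Real.log (Real.log N)) ≤ (k : ℝ)) :
    (Real.exp 1 ^ 2 / (k : ℝ) ^ (k - 1)) ^ (k + 1) ≤ 1 / N := by
  have hN0 : 0 < N := by linarith
  have hL : 1 < Real.log N := by
    rw [Real.lt_log_iff_exp_lt hN0]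
    linarith [Real.exp_one_lt_d9]
  obtain ⟨h3, hle⟩ := three_lt_and_le_sq_mul_log_sub hL hk
  have h4 : 4 ≤ k := by exact_mod_cast h3
  have h4' : (4 : ℝ) ≤ k := by exact_mod_cast h4
  have hk0 : (0 : ℝ) < k := by linarith
  have hlogk : Real.log k ≤ k - 1 := Real.log_le_sub_one_of_pos hk0
  rw [← Real.log_le_log_iff (by positivity) (by positivity), one_div, Real.log_inv, Real.log_pow,
    Real.log_div (by positivity) (by positivity), Real.log_pow, Real.log_pow, Real.log_exp]
  push_cast [Nat.cast_sub (show 1 ≤ k by omega)]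
  nlinarith

/-- If `N ≥ 16` is real and `k` is an integer with
`k ≥ 2·(ln N / ln ln N)^{1/2}`, then `(e²/k^{k-1})^{k+1} ≤ 1/N`.  Consequently, for
integers `Δ ≥ 1` and `n ≥ 1` with `2·Δ·n ≥ 16`, if
`k ≥ 2·(ln(2Δn)/ln ln(2Δn))^{1/2}` then `Δ·(e²/k^{k-1})^{k+1} ≤ 1/(2n)`. -/
theorem random_menu_k_bound :
    (∀ (N : ℝ) (k : ℕ), 16 ≤ N →
      2 * Real.sqrt (Real.log N / Real.log (Real.log N)) ≤ (k : ℝ) →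
      (Real.exp 1 ^ 2 / (k : ℝ) ^ (k - 1)) ^ (k + 1) ≤ 1 / N) ∧
    (∀ (Δ n k : ℕ), 1 ≤ Δ → 1 ≤ n → (16 : ℝ) ≤ 2 * (Δ : ℝ) * (n : ℝ) →
      2 * Real.sqrt (Real.log (2 * (Δ : ℝ) * (n : ℝ)) /
          Real.log (Real.log (2 * (Δ : ℝ) * (n : ℝ)))) ≤ (k : ℝ) →
      (Δ : ℝ) * ((Real.exp 1 ^ 2 / (k : ℝ) ^ (k - 1)) ^ (k + 1)) ≤ 1 / (2 * (n : ℝ))) := by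
  refine ⟨fun N k hN hk => exp_sq_div_pow_pow_le_one_div hN hk, fun Δ n k hΔ hn hN hk => ?_⟩
  have hΔ0 : (0 : ℝ) < Δ := by exact_mod_cast hΔ
  have hn0 : (0 : ℝ) < n := by exact_mod_cast hn
  calc (Δ : ℝ) * ((Real.exp 1 ^ 2 / (k : ℝ) ^ (k - 1)) ^ (k + 1))
      ≤ Δ * (1 / (2 * Δ * n)) := by
        gcongr
        exact exp_sq_div_pow_pow_le_one_div hN hk
    _ = 1 / (2 * n) := by field_simp
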